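/- Generalized Basic Lemma (multi-agent, set version): Let n be a natural number, let A, A_1, …, A_n be sets, and let R_1 ⊆ A × A_1, R_2 ⊆ A_1 × A_2, …, R_n ⊆ A_{n-1} × A_n, R_{n+1} ⊆ A_n × A be a belief cycle. Suppose that for every predicate p on A there exists c ∈ A such that: (i) for every chain y_1, …, y_n with R_1(c, y_1), R_2(y_1, y_2), …, R_n(y_{n-1}, y_n), and for every x ∈ A, R_{n+1}(y_n, x) ↔ p(x); and (ii) there exists y_1 with R_1(c, y_1), and for every partial chain y_1, …, y_k (1 ≤ k ≤ n-1) with R_1(c, y_1), …, R_k(y_{k-1}, y_k) there exists y_{k+1} with R_{k+1}(y_k, y_{k+1}). Then the composite relation R = R_1 ; R_2 ; … ; R_{n+1} ⊆ A × A, where R(x, x') holds iff there exist y_1, …, y_n with R_1(x, y_1), R_2(y_1, y_2), …, R_n(y_{n-1}, y_n), R_{n+1}(y_n, x'), is very weakly point surjective: for every predicate p on A there exists c ∈ A with R(c, c) ↔ p(c). -/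

import Mathlib

/-- A chain of length `k` for the relations `Rs` can be prolonged by one more related element. -/
theorem exists_chain_succ {A : ℕ → Type*} {Rs : ∀ i : ℕ, A i → A (i + 1) → Prop} {k : ℕ}
    (y : ∀ i, i ≤ k → A i) (hy : ∀ i (h : i < k), Rs i (y i h.le) (y (i + 1) h))
    {z : A (k + 1)} (hz : Rs k (y k le_rfl) z) :
    ∃ y' : ∀ i, i ≤ k + 1 → A i, y' 0 (Nat.zero_le _) = y 0 (Nat.zero_le k) ∧
      ∀ i (h : i < k + 1), Rs i (y' i h.le) (y' (i + 1) h) := by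
  refine ⟨fun i hi => if h : i ≤ k then y i h else
    (show i = k + 1 by omega) ▸ z, by simp, fun i h => ?_⟩
  obtain h' | rfl := Nat.lt_succ_iff_lt_or_eq.mp h
  · simpa [h'.le, Nat.succ_le_of_lt h'] using hy i h'
  · simpa using hz

/-- If every chain from `c` of length less than `n` can be prolonged, then there is a chain
from `c` of length `n`. -/
theorem exists_chain_of_extend {A : ℕ → Type*} {Rs : ∀ i : ℕ, A i → A (i + 1) → Prop} {n : ℕ}
    {c : A 0}
    (hext : ∀ k, k < n → ∀ y : ∀ i, i ≤ k → A i, y 0 (Nat.zero_le k) = c →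
      (∀ i (h : i < k), Rs i (y i h.le) (y (i + 1) h)) → ∃ z : A (k + 1), Rs k (y k le_rfl) z) :
    ∃ y : ∀ i, i ≤ n → A i, y 0 (Nat.zero_le n) = c ∧
      ∀ i (h : i < n), Rs i (y i h.le) (y (i + 1) h) := by
  induction n with
  | zero => exact ⟨fun i hi => (Nat.le_zero.mp hi).symm ▸ c, rfl, fun i h => absurd h i.not_lt_zero⟩
  | succ n ih =>
    obtain ⟨y, hy0, hy⟩ := ih fun k hk => hext k (hk.trans n.lt_succ_self)
    obtain ⟨z, hz⟩ := hext n n.lt_succ_self y hy0 hy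
    obtain ⟨y', hy0', hy'⟩ := exists_chain_succ y hy hz
    exact ⟨y', hy0'.trans hy0, hy'⟩

/-- Generalized Basic Lemma (multi-agent, set version).

A belief cycle on sets `A 0, A 1, …, A n` is given by relations
`Rs i : A i → A (i+1) → Prop` for `i < n` (these are `R_1, …, R_n` of the
informal statement, so `Rs i = R_{i+1}`) together with the closing relation
`Rlast : A n → A 0 → Prop` (which is `R_{n+1}`).  A chain from `c` of length `k`
is a family `y i` (for `i ≤ k`) with `y 0 = c` and `Rs i (y i) (y (i+1))` for
all `i < k`.

The generalized BK assumptions say: for every predicate `p` on `A 0` there is a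
point `c` such that (i) along every full chain `y` from `c`, for all `x`,
`Rlast (y n) x ↔ p x`; and (ii) there is `y₁` with `R_1(c, y₁)` (when `n = 0`
the first relation `R_1` is `Rlast` itself), and every partial chain
`y_1, …, y_k` from `c` with `1 ≤ k ≤ n - 1` extends by some `y_{k+1}` with
`R_{k+1}(y_k, y_{k+1})`.

Conclusion: the composite relation `R = R_1 ; ⋯ ; R_{n+1}` on `A 0` is very
weakly point surjective. -/
theorem generalized_basic_lemma (n : ℕ) (A : ℕ → Type*)
    (Rs : ∀ i : ℕ, A i → A (i + 1) → Prop) (Rlast : A n → A 0 → Prop)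
    (H : ∀ p : A 0 → Prop, ∃ c : A 0,
      -- (i): along every full chain from `c`, the last relation assumes `p`
      (∀ y : ∀ i, i ≤ n → A i, y 0 (Nat.zero_le n) = c →
        (∀ i (h : i < n), Rs i (y i (Nat.le_of_lt h)) (y (i + 1) h)) →
        ∀ x : A 0, Rlast (y n le_rfl) x ↔ p x) ∧
      -- (ii-a): there is `y₁` with `R_1 c y₁`
      (0 < n → ∃ y1 : A 1, Rs 0 c y1) ∧
      (∀ h : n = 0, ∃ y : A 0, (h ▸ Rlast) c y) ∧
      -- (ii-b): every partial chain from `c` of length `k`, `1 ≤ k ≤ n - 1`, extends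
      (∀ k, 1 ≤ k → k ≤ n - 1 → ∀ y : ∀ i, i ≤ k → A i,
        y 0 (Nat.zero_le k) = c →
        (∀ i (h : i < k), Rs i (y i (Nat.le_of_lt h)) (y (i + 1) h)) →
        ∃ z : A (k + 1), Rs k (y k le_rfl) z)) :
    ∀ p : A 0 → Prop, ∃ c : A 0,
      ((∃ y : ∀ i, i ≤ n → A i, y 0 (Nat.zero_le n) = c ∧
        (∀ i (h : i < n), Rs i (y i (Nat.le_of_lt h)) (y (i + 1) h)) ∧
        Rlast (y n le_rfl) c) ↔ p c) := by
  intro p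
  obtain ⟨c, hlast, hfirst, -, hext⟩ := H p
  refine ⟨c, fun ⟨y, hy0, hy, hc⟩ => (hlast y hy0 hy c).mp hc, fun hp => ?_⟩
  obtain ⟨y, hy0, hy⟩ := exists_chain_of_extend (Rs := Rs) (n := n) (c := c) fun k hk y hy0 hy => by
    obtain rfl | hk0 := k.eq_zero_or_pos
    · exact hy0 ▸ hfirst hk
    · exact hext k hk0 (Nat.le_sub_one_of_lt hk) y hy0 hy
  exact ⟨y, hy0, hy, (hlast y hy0 hy c).mpr hp⟩
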